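/- Fix a ∈ ℝ and let (Φ, W, Ψ, θ) be a solution of system (D) defined for all τ ∈ ℝ with Φ(τ) > 0 and θ(τ) ∈ (−π/2, π/2) for all τ. Suppose liminf_{τ→−∞} Φ(τ) < ∞ and limsup_{τ→−∞} ( Φ(τ) + |W(τ)| + |Ψ(τ)| ) = ∞. Then there exist a strictly decreasing sequence (τₙ*) with τₙ* → −∞, positive numbers εₙ, and an index n₀ ∈ ℕ such that: for every n, Φ(τₙ*) = max_{τ ∈ [τₙ* − εₙ, τₙ* + εₙ]} Φ(τ); limsup_{n→∞} Φ(τₙ*) = ∞; and Φ(τₙ₋₁*) > Φ(τₙ*) for all n > n₀. -/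

import Mathlib

open Filter Set

/-- The right-hand side of the `Ψ` equation in system (D). -/
noncomputable def dPsi (a Φ W Ψ θ : ℝ) : ℝ :=
  1 / Φ ^ 3 - 1 - (a - 1) * Real.cos θ ^ 2 -
    (((16 / 3) * Real.sin θ - (224 / 27) * Real.sin θ ^ 3) * Real.cos θ ^ ((17 : ℝ) / 3) * Φ
      + ((208 / 81) * Real.sin θ ^ 2 - 10 / 9) * Real.cos θ ^ ((34 : ℝ) / 9) * W
      + (2 / 3) * Real.sin θ * Real.cos θ ^ ((17 : ℝ) / 9) * Ψ)

/-- `(Φ, W, Ψ, θ)` is a solution of system (D) on all of `ℝ`. -/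
noncomputable def SolD (a : ℝ) (Φ W Ψ θ : ℝ → ℝ) : Prop :=
  ∀ τ : ℝ,
    HasDerivAt Φ (W τ) τ ∧
    HasDerivAt W (Ψ τ) τ ∧
    HasDerivAt Ψ (dPsi a (Φ τ) (W τ) (Ψ τ) (θ τ)) τ ∧
    HasDerivAt θ (Real.cos (θ τ) ^ ((26 : ℝ) / 9)) τ


lemma first_time {f : ℝ → ℝ} (hf : Continuous f) {x y d : ℝ} (hxy : x ≤ y) (hx : d < f x)
    (hy : f y ≤ d) : ∃ c, x < c ∧ c ≤ y ∧ f c = d ∧ ∀ t, x ≤ t → t < c → d < f t := by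
  let A : Set ℝ := Icc x y ∩ f ⁻¹' (Iic d)
  have hAc : IsClosed A := isClosed_Icc.inter (isClosed_Iic.preimage hf)
  have hne : A.Nonempty := ⟨y, ⟨hxy, le_refl _⟩, hy⟩
  have hbd : BddBelow A := ⟨x, fun t ht => ht.1.1⟩
  have hm := hAc.csInf_mem hne hbd
  set c := sInf A with hc
  have hlt : ∀ t, x ≤ t → t < c → d < f t := by
    intro t ht htc
    by_contra hcon
    exact absurd (csInf_le hbd (show t ∈ A from ⟨⟨ht, htc.le.trans hm.1.2⟩, not_lt.1 hcon⟩)) (not_le.2 htc)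
  have hxc : x < c := by
    rcases lt_or_eq_of_le hm.1.1 with h | h
    · exact h
    · exfalso
      have : f c ≤ d := hm.2
      rw [← h] at this
      linarith
  refine ⟨c, hxc, hm.1.2, le_antisymm hm.2 ?_, hlt⟩
  by_contra hcon
  push Not at hcon
  obtain ⟨z, hz, hz2⟩ := intermediate_value_Icc' hxc.le hf.continuousOn
    (show (f c + d)/2 ∈ Icc (f c) (f x) from ⟨by linarith, by linarith⟩)
  have : z ≠ c := by rintro rfl; linarith
  have := hlt z hz.1 (lt_of_le_of_ne hz.2 this)
  linarith

lemma last_time {f : ℝ → ℝ} (hf : Continuous f) {x y d : ℝ} (hxy : x ≤ y) (hx : f x ≤ d)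
    (hy : d < f y) : ∃ c, x ≤ c ∧ c < y ∧ f c = d ∧ ∀ t, c < t → t ≤ y → d < f t := by
  obtain ⟨c, h1, h2, h3, h4⟩ := first_time (f := fun t => f (-t)) (by fun_prop) (x := -y) (y := -x) (d := d)
    (by linarith) (by simpa using hy) (by simpa using hx)
  refine ⟨-c, by linarith, by linarith, h3, fun t ht hty => ?_⟩
  simpa using h4 (-t) (by linarith) (by linarith)

lemma mvt_ge' {f f' : ℝ → ℝ} {x y c : ℝ} (hxy : x ≤ y)
    (hf : ∀ t, x ≤ t → t ≤ y → HasDerivAt f (f' t) t)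
    (h : ∀ t, x ≤ t → t ≤ y → c ≤ f' t) : c * (y - x) ≤ f y - f x := by
  rcases eq_or_lt_of_le hxy with rfl | hlt
  · simp
  obtain ⟨z, hz, he⟩ := exists_hasDerivAt_eq_slope f f' hlt
    (fun t ht => (hf t ht.1 ht.2).continuousAt.continuousWithinAt) (fun t ht => hf t ht.1.le ht.2.le)
  have := h z hz.1.le hz.2.le
  rw [he, le_div_iff₀ (by linarith)] at this
  exact this

lemma mvt_ge {f f' : ℝ → ℝ} {x y c : ℝ} (hxy : x ≤ y) (hf : ∀ t, HasDerivAt f (f' t) t)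
    (h : ∀ t, x ≤ t → t ≤ y → c ≤ f' t) : c * (y - x) ≤ f y - f x :=
  mvt_ge' hxy (fun t _ _ => hf t) h

lemma mvt_le {f f' : ℝ → ℝ} {x y c : ℝ} (hxy : x ≤ y) (hf : ∀ t, HasDerivAt f (f' t) t)
    (h : ∀ t, x ≤ t → t ≤ y → f' t ≤ c) : f y - f x ≤ c * (y - x) := by
  have := mvt_ge (f := fun t => - f t) (f' := fun t => - f' t) (c := -c) hxy (fun t => (hf t).neg)
    (fun t h1 h2 => by have := h t h1 h2; linarith)
  linarith

lemma D2 {f f1 f2 : ℝ → ℝ} {x δ c : ℝ} (hδ : 0 ≤ δ) (h0 : ∀ t, HasDerivAt f (f1 t) t)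
    (h1 : ∀ t, HasDerivAt f1 (f2 t) t)
    (h : ∀ t, x ≤ t → t ≤ x + 2 * δ → c ≤ f2 t) :
    c * δ ^ 2 ≤ f (x + 2 * δ) - 2 * f (x + δ) + f x := by
  have := mvt_ge (f := fun t => f (t + δ) - f t) (f' := fun t => f1 (t + δ) - f1 t) (x := x) (y := x + δ)
    (c := c * δ) (by linarith) (fun t => ((h0 (t + δ)).comp_add_const t δ).sub (h0 t)) (by
      intro t ht1 ht2
      have := mvt_ge (x := t) (y := t + δ) (by linarith) h1 (c := c)
        (fun r hr1 hr2 => h r (by linarith) (by linarith))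
      linarith)
  have e : x + δ + δ = x + 2 * δ := by ring
  simp only [e] at this
  nlinarith

lemma D3 {f f1 f2 f3 : ℝ → ℝ} {x δ c : ℝ} (hδ : 0 ≤ δ) (h0 : ∀ t, HasDerivAt f (f1 t) t)
    (h1 : ∀ t, HasDerivAt f1 (f2 t) t) (h2 : ∀ t, HasDerivAt f2 (f3 t) t)
    (h : ∀ t, x ≤ t → t ≤ x + 3 * δ → c ≤ f3 t) :
    c * δ ^ 3 ≤ f (x + 3 * δ) - 3 * f (x + 2 * δ) + 3 * f (x + δ) - f x := by
  have := D2 (f := fun t => f (t + δ) - f t) (f1 := fun t => f1 (t + δ) - f1 t)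
    (f2 := fun t => f2 (t + δ) - f2 t) (x := x) (c := c * δ) hδ
    (fun t => ((h0 (t + δ)).comp_add_const t δ).sub (h0 t))
    (fun t => ((h1 (t + δ)).comp_add_const t δ).sub (h1 t)) (by
      intro t ht1 ht2
      have := mvt_ge (x := t) (y := t + δ) (by linarith) h2 (c := c)
        (fun r hr1 hr2 => h r (by linarith) (by linarith))
      linarith)
  have e : x + δ + δ = x + 2 * δ := by ring
  have e' : x + 2 * δ + δ = x + 3 * δ := by ring
  simp only [e, e'] at this
  nlinarith

/-- the reduced third order equation -/
structure Sys (a : ℝ) (H H1 H2 : ℝ → ℝ) : Prop where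
  d0 : ∀ t, HasDerivAt H (H1 t) t
  d1 : ∀ t, HasDerivAt H1 (H2 t) t
  d2 : ∀ t, HasDerivAt H2 (t ^ 2 + a - 1 / H t ^ 3) t
  pos : ∀ t, 0 < H t
  recur : ∃ N : ℝ, ∀ S : ℝ, ∃ s, S ≤ s ∧ H s ≤ N

namespace Sys
variable {a : ℝ} {H H1 H2 : ℝ → ℝ}

lemma c0 (h : Sys a H H1 H2) : Continuous H :=
  continuous_iff_continuousAt.2 fun t => (h.d0 t).continuousAt
lemma c1 (h : Sys a H H1 H2) : Continuous H1 :=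
  continuous_iff_continuousAt.2 fun t => (h.d1 t).continuousAt
lemma c2 (h : Sys a H H1 H2) : Continuous H2 :=
  continuous_iff_continuousAt.2 fun t => (h.d2 t).continuousAt

/-- no third derivative bounded below by a positive constant -/
lemma no_escape0 (h : Sys a H H1 H2) {s η : ℝ} (hη : 0 < η)
    (hh : ∀ t, s ≤ t → η ≤ t ^ 2 + a - 1 / H t ^ 3) : False := by
  obtain ⟨N, hN⟩ := h.recur
  have k2 : ∀ t, s ≤ t → H2 s + η * (t - s) ≤ H2 t := fun t ht => by
    have := mvt_ge ht h.d2 (c := η) (fun r h1 _ => hh r h1)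
    linarith
  -- time after which H2 ≥ 1
  obtain ⟨s1, hs1, hs1'⟩ : ∃ s1, s ≤ s1 ∧ ∀ t, s1 ≤ t → 1 ≤ H2 t := by
    refine ⟨s + (1 + |H2 s|) / η, by have : 0 ≤ (1 + |H2 s|) / η := by positivity
                                     linarith, fun t ht => ?_⟩
    have h3 : (1 + |H2 s|) / η ≤ t - s := by linarith
    rw [div_le_iff₀ hη] at h3
    have h4 := k2 t (by have : 0 ≤ (1 + |H2 s|) / η := by positivity
                        linarith)
    have := neg_abs_le (H2 s)
    nlinarith
  obtain ⟨s2, hs2, hs2'⟩ : ∃ s2, s1 ≤ s2 ∧ ∀ t, s2 ≤ t → 1 ≤ H1 t := by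
    refine ⟨s1 + (1 + |H1 s1|), by have := abs_nonneg (H1 s1); linarith, fun t ht => ?_⟩
    have h4 := mvt_ge (x := s1) (y := t) (by have := abs_nonneg (H1 s1); linarith) h.d1 (c := 1) (fun r h1 _ => hs1' r h1)
    have := neg_abs_le (H1 s1)
    linarith
  obtain ⟨t, ht, htN⟩ := hN (s2 + |N| + 1)
  have h4 := mvt_ge (x := s2) (y := t) (by have := abs_nonneg N; linarith) h.d0 (c := 1) (fun r h1 _ => hs2' r h1)
  have := h.pos s2
  have := le_abs_self N
  linarith

/-- if `H' ≥ 0`, `H'' ≥ 0` then `q H³ ≤ 1`. -/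
lemma no_escape (h : Sys a H H1 H2) {s : ℝ} (hs : 0 ≤ s)
    (h1 : 0 ≤ H1 s) (h2 : 0 ≤ H2 s) : (s ^ 2 + a) * H s ^ 3 ≤ 1 := by
  by_contra hcon
  push Not at hcon
  -- choose d < H s with q d^3 > 1
  have hcont : ContinuousAt (fun x : ℝ => (s ^ 2 + a) * x ^ 3) (H s) := by fun_prop
  have hev := (hcont.eventually (lt_mem_nhds hcon)).and (lt_mem_nhds (h.pos s))
  obtain ⟨d, ⟨hd1, hd0⟩, hd2⟩ : ∃ d, (1 < (s ^ 2 + a) * d ^ 3 ∧ 0 < d) ∧ d < H s :=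
    ((hev.filter_mono nhdsWithin_le_nhds).and (self_mem_nhdsWithin (s := Iio (H s)))).exists
  have key : ∀ t, s ≤ t → d ≤ H t → s ^ 2 + a - 1 / d ^ 3 ≤ t ^ 2 + a - 1 / H t ^ 3 := by
    intro t ht hdt
    have e1 : s ^ 2 ≤ t ^ 2 := by nlinarith
    have e2 : 1 / H t ^ 3 ≤ 1 / d ^ 3 := by gcongr
    linarith
  have hη : 0 < s ^ 2 + a - 1 / d ^ 3 := by
    have : 1 / d ^ 3 < s ^ 2 + a := by rw [div_lt_iff₀ (by positivity)]; exact hd1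
    linarith
  have hall : ∀ t, s ≤ t → d ≤ H t := by
    intro t ht
    by_contra hlt
    push Not at hlt
    obtain ⟨c, hc1, hc2, hc3, hc4⟩ := first_time h.c0 ht hd2 hlt.le
    have hge : ∀ r, s ≤ r → r ≤ c → d ≤ H r := fun r hr1 hr2 => by
      rcases eq_or_lt_of_le hr2 with rfl | hr3
      · exact hc3.ge
      · exact (hc4 r hr1 hr3).le
    have k2 : ∀ r, s ≤ r → r ≤ c → 0 ≤ H2 r := fun r hr1 hr2 => by
      have := mvt_ge hr1 h.d2 (c := 0) (fun u hu1 hu2 => hη.le.trans (key u hu1 (hge u hu1 (by linarith))))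
      linarith
    have k1 : ∀ r, s ≤ r → r ≤ c → 0 ≤ H1 r := fun r hr1 hr2 => by
      have := mvt_ge hr1 h.d1 (c := 0) (fun u hu1 hu2 => k2 u hu1 (by linarith))
      linarith
    have := mvt_ge hc1.le h.d0 (c := 0) k1
    linarith
  exact h.no_escape0 hη (fun t ht => key t ht (hall t ht))

end Sys

noncomputable def ell (s : ℝ) : ℝ := (1 + s ^ 2) ^ ((1 : ℝ) / 9)

lemma ell_pow (s : ℝ) : ell s ^ 9 = 1 + s ^ 2 := by
  unfold ell
  rw [← Real.rpow_natCast, ← Real.rpow_mul (by positivity)]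
  norm_num

lemma ell_pos (s : ℝ) : 0 < ell s := by unfold ell; positivity

lemma ell_ge_one (s : ℝ) : 1 ≤ ell s := by
  unfold ell; exact Real.one_le_rpow (by nlinarith [sq_nonneg s]) (by norm_num)

lemma ell_mono {s t : ℝ} (hs : 0 ≤ s) (hst : s ≤ t) : ell s ≤ ell t := by
  unfold ell
  apply Real.rpow_le_rpow (by positivity) (by nlinarith) (by norm_num)

lemma ell_ratio {s t m : ℝ} (hm : 0 ≤ m) (h : 1 + t ^ 2 ≤ m ^ 3 * (1 + s ^ 2)) :
    ell t ^ 3 ≤ m * ell s ^ 3 := by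
  rw [← ell_pow, ← ell_pow] at h
  have := ell_pos s
  have := ell_pos t
  apply le_of_pow_le_pow_left₀ (n := 3) (by norm_num) (by positivity)
  calc _ = ell t ^ 9 := by ring
    _ ≤ _ := h
    _ = _ := by ring

lemma ell_ratio1 {s t m : ℝ} (hm : 0 ≤ m) (h : 1 + t ^ 2 ≤ m ^ 9 * (1 + s ^ 2)) :
    ell t ≤ m * ell s := by
  rw [← ell_pow, ← ell_pow] at h
  have := ell_pos s
  have := ell_pos t
  apply le_of_pow_le_pow_left₀ (n := 9) (by norm_num) (by positivity)
  rw [mul_pow]; exact h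

lemma ell_cont : Continuous ell := by
  unfold ell
  apply Continuous.rpow_const (by fun_prop)
  intro x; left; positivity

noncomputable def base (a : ℝ) : ℝ := 10 + 2 * |a|

lemma base_ge (a : ℝ) : 10 ≤ base a := by unfold base; have := abs_nonneg a; linarith

lemma q_lo {a s : ℝ} (h : base a ≤ s) : ell s ^ 9 ≤ 2 * (s ^ 2 + a) := by
  rw [ell_pow]; unfold base at h
  have := abs_nonneg a; have := neg_abs_le a
  nlinarith

lemma q_hi {a s : ℝ} (h : base a ≤ s) : s ^ 2 + a ≤ 2 * ell s ^ 9 := by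
  rw [ell_pow]; unfold base at h
  have := abs_nonneg a; have := le_abs_self a
  nlinarith

lemma q_big {a s : ℝ} (h : base a ≤ s) : 50 ≤ s ^ 2 + a := by
  unfold base at h
  have := abs_nonneg a; have := neg_abs_le a
  nlinarith

lemma q_mono {a s t : ℝ} (h : base a ≤ s) (hst : s ≤ t) : s ^ 2 + a ≤ t ^ 2 + a := by
  have := base_ge a
  nlinarith

namespace Sys
variable {a : ℝ} {H H1 H2 : ℝ → ℝ}

lemma exists_nonpos (h : Sys a H H1 H2) (S : ℝ) : ∃ s, S ≤ s ∧ H1 s ≤ 0 := by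
  by_contra hcon
  push Not at hcon
  set S' := max S (base a) with hS'
  have hb := base_ge a
  have hSb : base a ≤ S' := le_max_right _ _
  have hSS : S ≤ S' := le_max_left _ _
  have hmono : ∀ t, S' ≤ t → H S' ≤ H t := fun t ht => by
    have := mvt_ge ht h.d0 (c := 0) (fun r h1 _ => (hcon r (by linarith)).le)
    linarith
  have hp := h.pos S'
  have hp2 : 0 < 1 / H S' ^ 3 := by positivity
  refine h.no_escape0 (s := S' + |a| + 1 / H S' ^ 3 + 1) (η := 1) one_pos (fun t ht => ?_)
  have ha := abs_nonneg a
  have e2 : 1 / H t ^ 3 ≤ 1 / H S' ^ 3 := by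
    have := hmono t (by linarith)
    gcongr
  have := neg_abs_le a
  nlinarith

lemma exists_le (h : Sys a H H1 H2) (S : ℝ) : ∃ s, S ≤ s ∧ (s ^ 2 + a) * H s ^ 3 ≤ 8 := by
  by_contra hcon
  push Not at hcon
  refine h.no_escape0 (s := max S (base a)) (η := 1) one_pos (fun t ht => ?_)
  have hSb : base a ≤ t := (le_max_right _ _).trans ht
  have hSS : S ≤ t := (le_max_left _ _).trans ht
  have h1 := hcon t hSS
  have h2 := q_big hSb
  have := h.pos t
  have : 1 / H t ^ 3 ≤ (t ^ 2 + a) / 8 := by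
    rw [div_le_iff₀ (by positivity)]; linarith
  linarith

lemma apriori (h : Sys a H H1 H2) : ∃ C0 : ℝ, 1 ≤ C0 ∧ ∀ s, base a ≤ s → H2 s ≤ C0 * (s * ell s ^ 9) := by
  refine ⟨2 + |H2 (base a)|, by have := abs_nonneg (H2 (base a)); linarith, fun s hs => ?_⟩
  have h1 := mvt_le hs h.d2 (c := 2 * ell s ^ 9) (fun r hr1 hr2 => by
    have := h.pos r
    have : 0 < 1 / H r ^ 3 := by positivity
    have := q_mono hr1 hr2
    have := q_hi hs
    linarith)
  have h2 := le_abs_self (H2 (base a))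
  have h0 := abs_nonneg (H2 (base a))
  have h3 := base_ge a
  have h4 : 1 ≤ ell s ^ 9 := one_le_pow₀ (ell_ge_one s)
  have h5 : 1 ≤ s * ell s ^ 9 := by nlinarith
  nlinarith

lemma upK (h : Sys a H H1 H2) {C0 : ℝ} (hC0 : 1 ≤ C0)
    (hap : ∀ s, base a ≤ s → H2 s ≤ C0 * (s * ell s ^ 9)) {t ν : ℝ} (ht : 2 * base a ≤ t)
    (hν : 1 ≤ ν) (hb : ∀ u, t / 2 ≤ u → u ≤ t → H u * ell u ^ 3 ≤ ν ^ 15) :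
    H2 t ≤ (18 + 2 * C0) * (ell t ^ 5 * ν ^ 5) := by
  have hbase := base_ge a
  have hl := ell_pos t
  have hν0 : 0 < ν := by linarith
  set l := ell t with hlt
  have hX : ∀ u, t / 2 ≤ u → u ≤ t → H u * l ^ 3 ≤ 2 * ν ^ 15 := by
    intro u hu1 hu2
    have h1 := ell_ratio (s := u) (t := t) (m := 2) (by norm_num) (by nlinarith)
    have h2 := hb u hu1 hu2
    have := h.pos u
    nlinarith
  by_cases hR : t / 2 ≤ ν ^ 5 / l ^ 4
  · have h1 := hap t (by linarith)
    rw [le_div_iff₀ (by positivity)] at hR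
    have h2 : t * l ^ 9 ≤ 2 * (l ^ 5 * ν ^ 5) := by
      calc t * l ^ 9 = 2 * l ^ 5 * (t / 2 * l ^ 4) := by ring
        _ ≤ 2 * l ^ 5 * ν ^ 5 := by gcongr
        _ = _ := by ring
    have h3 : 0 < l ^ 5 * ν ^ 5 := by positivity
    nlinarith
  · push Not at hR
    set R := ν ^ 5 / l ^ 4 with hRd
    have hR0 : 0 < R := by positivity
    have hRl : R * l ^ 4 = ν ^ 5 := by rw [hRd]; field_simp
    have hlow : ∀ u, t - R ≤ u → u ≤ t → H2 t - 2 * l ^ 9 * R ≤ H2 u := by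
      intro u hu1 hu2
      have h1 := mvt_le hu2 h.d2 (c := 2 * l ^ 9) (fun r hr1 hr2 => by
        have := h.pos r
        have : 0 < 1 / H r ^ 3 := by positivity
        have := q_mono (a := a) (s := r) (by linarith) hr2
        have := q_hi (a := a) (s := t) (by linarith)
        linarith)
      have : 2 * l ^ 9 * (t - u) ≤ 2 * l ^ 9 * R := by
        have : t - u ≤ R := by linarith
        gcongr
      linarith
    have h2 := D2 (x := t - R) (δ := R / 2) (c := H2 t - 2 * l ^ 9 * R) (by positivity) h.d0 h.d1
      (fun u hu1 hu2 => hlow u hu1 (by linarith))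
    have e1 : t - R + 2 * (R / 2) = t := by ring
    rw [e1] at h2
    have h3 := h.pos (t - R + R / 2)
    have h4 := hX t (by linarith) le_rfl
    have h5 := hX (t - R) (by linarith) (by linarith)
    have h6 : (H2 t - 2 * l ^ 9 * R) * (R / 2) ^ 2 ≤ H t + H (t - R) := by linarith
    have h7 : (H2 t - 2 * l ^ 9 * R) * (R / 2) ^ 2 * l ^ 3 ≤ 4 * ν ^ 15 := by
      have : (H2 t - 2 * l ^ 9 * R) * (R / 2) ^ 2 * l ^ 3 ≤ (H t + H (t - R)) * l ^ 3 := by gcongr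
      linarith
    have e2 : l ^ 9 * R = l ^ 5 * ν ^ 5 := by rw [← hRl]; ring
    have h8 : (H2 t - 2 * l ^ 9 * R) * ν ^ 10 ≤ (16 * (l ^ 5 * ν ^ 5)) * ν ^ 10 := by
      have e3 : ν ^ 10 = R ^ 2 * l ^ 8 := by
        have : ν ^ 10 = (ν ^ 5) ^ 2 := by ring
        rw [this, ← hRl]; ring
      have : (H2 t - 2 * l ^ 9 * R) * ν ^ 10 = 4 * l ^ 5 * ((H2 t - 2 * l ^ 9 * R) * (R / 2) ^ 2 * l ^ 3) := by
        rw [e3]; ring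
      rw [this]
      calc _ ≤ 4 * l ^ 5 * (4 * ν ^ 15) := by gcongr
        _ = _ := by ring
    have h9 := le_of_mul_le_mul_right h8 (by positivity)
    have h10 : 0 < l ^ 5 * ν ^ 5 := by positivity
    nlinarith

lemma lowH (h : Sys a H H1 H2) {s K : ℝ} (hs : base a + 1 ≤ s) (h1 : H1 s = 0) (h2 : 0 ≤ H2 s)
    (hK : 1 ≤ K) (hb : ∀ u, s - 1 ≤ u → u ≤ s → H2 u ≤ K) :
    (1 / H s) ^ 3 ≤ 128 * ell s ^ 9 ∨ (1 / H s) ^ 5 ≤ 2048 * K ^ 3 := by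
  have hp := h.pos s
  have hbase := base_ge a
  set y := H s with hy
  have hq := q_big (a := a) (s := s) (by linarith)
  by_cases hc : 1 ≤ 64 * ((s ^ 2 + a) * y ^ 3)
  · left
    have := q_hi (a := a) (s := s) (by linarith)
    rw [div_pow, one_pow, div_le_iff₀ (by positivity)]
    have hy3 : 0 < y ^ 3 := by positivity
    nlinarith
  · right
    push Not at hc
    have hy1 : y ≤ 1 / 4 := by
      by_contra hh
      push Not at hh
      have : (1/4 : ℝ) ^ 3 < y ^ 3 := by gcongr
      nlinarith
    set r := Real.sqrt (2 * y / K) with hr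
    have hr2 : r ^ 2 = 2 * y / K := Real.sq_sqrt (by positivity)
    have hr0 : 0 < r := by positivity
    have hr1 : r ≤ 1 := by
      refine Real.sqrt_le_iff.2 ⟨zero_le_one, ?_⟩; rw [one_pow]
      rw [div_le_one (by linarith)]
      linarith
    have k1 : ∀ u, s - r ≤ u → u ≤ s → - (K * r) ≤ H1 u := by
      intro u hu1 hu2
      have := mvt_le hu2 h.d1 (c := K) (fun v hv1 hv2 => hb v (by linarith) hv2)
      have : K * (s - u) ≤ K * r := by
        have : s - u ≤ r := by linarith
        gcongr
      linarith
    have k0 : ∀ u, s - r ≤ u → u ≤ s → H u ≤ 3 * y := by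
      intro u hu1 hu2
      have h3 := mvt_ge hu2 h.d0 (c := -(K * r)) (fun v hv1 hv2 => k1 v (by linarith) hv2)
      have h4 : K * r * (s - u) ≤ K * r * r := by
        have : s - u ≤ r := by linarith
        gcongr
      have h5 : K * r * r = 2 * y := by
        rw [mul_assoc, ← sq, hr2]; field_simp
      linarith
    have h3 := mvt_le (x := s - r) (y := s) (by linarith) h.d2 (c := - (1 / (64 * y ^ 3))) (by
      intro u hu1 hu2
      have h5 := k0 u hu1 hu2
      have hpu := h.pos u
      have h6 : 1 / (3 * y) ^ 3 ≤ 1 / H u ^ 3 := by gcongr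
      have h7 := q_mono (a := a) (s := u) (by linarith) hu2
      have h8 : s ^ 2 + a ≤ 1 / (64 * y ^ 3) := by
        rw [le_div_iff₀ (by positivity)]; linarith
      have h9 : 1 / (64 * y ^ 3) + 1 / (64 * y ^ 3) ≤ 1 / (3 * y) ^ 3 := by
        have : 0 < 1 / y ^ 3 := by positivity
        have e1 : 1 / (64 * y ^ 3) = 1 / 64 * (1 / y ^ 3) := by field_simp
        have e2 : 1 / (3 * y) ^ 3 = 1 / 27 * (1 / y ^ 3) := by field_simp; ring
        rw [e1, e2]; linarith
      linarith)
    have h4 := hb (s - r) (by linarith) (by linarith)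
    have h5 : r / (64 * y ^ 3) ≤ K := by
      have : - (1 / (64 * y ^ 3)) * (s - (s - r)) = - (r / (64 * y ^ 3)) := by ring
      linarith
    rw [div_le_iff₀ (by positivity)] at h5
    have h6 : r ^ 2 ≤ (K * (64 * y ^ 3)) ^ 2 := by gcongr
    rw [hr2, div_le_iff₀ (by linarith)] at h6
    have h7 : (2 * y) * 1 ≤ (2 * y) * (2048 * K ^ 3 * y ^ 5) := by
      calc _ = 2 * y := by ring
        _ ≤ _ := h6
        _ = _ := by ring
    have h8 := le_of_mul_le_mul_left h7 (by positivity)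
    rw [div_pow, one_pow, div_le_iff₀ (by positivity)]
    exact h8

end Sys

namespace Sys
variable {a : ℝ} {H H1 H2 : ℝ → ℝ}

/-- On the region where `q H³ ≥ 8`, `H'` cannot turn from nonpositive to positive. -/
lemma stay (h : Sys a H H1 H2) {x y : ℝ} (hx : base a ≤ x) (hxy : x ≤ y)
    (hq : ∀ u, x ≤ u → u ≤ y → 8 ≤ (u ^ 2 + a) * H u ^ 3) (h1 : H1 x ≤ 0) : H1 y ≤ 0 := by
  by_contra hcon
  push Not at hcon
  have hb := base_ge a
  obtain ⟨c, hc1, hc2, hc3, hc4⟩ := last_time h.c1 hxy h1 hcon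
  obtain ⟨z, hz, he⟩ := exists_hasDerivAt_eq_slope H1 H2 hc2
    (fun t _ => (h.d1 t).continuousAt.continuousWithinAt) (fun t _ => h.d1 t)
  have hz2 : 0 < H2 z := by
    rw [he, hc3]
    apply div_pos <;> linarith
  have h3 := h.no_escape (s := z) (by linarith [hz.1]) (hc4 z hz.1 hz.2.le).le hz2.le
  have h4 := hq z (by linarith [hz.1]) hz.2.le
  linarith

lemma decr (h : Sys a H H1 H2) {x y : ℝ} (hx : base a ≤ x) (hxy : x ≤ y)
    (hq : ∀ u, x ≤ u → u ≤ y → 8 ≤ (u ^ 2 + a) * H u ^ 3) (h1 : H1 x ≤ 0) : H y ≤ H x := by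
  have := mvt_le hxy h.d0 (c := 0) (fun u hu1 hu2 =>
    h.stay hx hu1 (fun v hv1 hv2 => hq v hv1 (by linarith)) h1)
  linarith

/-- energy monotonicity -/
lemma energy (h : Sys a H H1 H2) {x y : ℝ} (hx : base a ≤ x) (hxy : x ≤ y)
    (h1 : ∀ u, x ≤ u → u ≤ y → 0 ≤ H1 u) (h2 : ∀ u, x ≤ u → u ≤ y → H2 u ≤ 0) (h2x : H2 x = 0) :
    H y ≤ H x + 1 / (2 * H x ^ 2) / (x ^ 2 + a) := by
  have hb := base_ge a
  have key := mvt_ge' (f := fun t => - (H t + (1 / (2 * H t ^ 2) - H1 t * H2 t) / (t ^ 2 + a)))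
    (f' := fun t => H2 t ^ 2 / (t ^ 2 + a) + (1 / (2 * H t ^ 2) - H1 t * H2 t) * (2 * t) / (t ^ 2 + a) ^ 2)
    (c := 0) hxy (by
      intro t ht1 ht2
      have hp := h.pos t
      have hq := q_big (a := a) (s := t) (by linarith)
      have e1 : HasDerivAt (fun t => 1 / (2 * H t ^ 2)) (- (H1 t / H t ^ 3)) t := by
        have := (((h.d0 t).pow 2).const_mul 2).inv (by simpa using hp.ne')
        simp only [one_div]
        refine this.congr_deriv ?_
        simp
        field_simp
        try ring
      have e2 := (h.d1 t).mul (h.d2 t)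
      have e3 : HasDerivAt (fun t : ℝ => t ^ 2 + a) (2 * t) t := by
        simpa using (hasDerivAt_pow 2 t).add_const a
      have e4 := ((h.d0 t).add ((e1.sub e2).div e3 (by linarith))).neg
      refine e4.congr_deriv ?_
      have : t ^ 2 + a ≠ 0 := by linarith
      simp only [Pi.sub_apply, Pi.mul_apply]
      field_simp
      ring) (by
      intro t ht1 ht2
      have hp := h.pos t
      have hq := q_big (a := a) (s := t) (by linarith)
      have := h1 t ht1 ht2
      have := h2 t ht1 ht2
      have h3 : 0 ≤ 1 / (2 * H t ^ 2) - H1 t * H2 t := by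
        have : 0 < 1 / (2 * H t ^ 2) := by positivity
        nlinarith
      have : 0 < t := by linarith
      have hq' : 0 < t ^ 2 + a := by linarith
      positivity)
  simp only [h2x] at key
  have hp := h.pos y
  have hq := q_big (a := a) (s := y) (by linarith)
  have h3 : 0 ≤ 1 / (2 * H y ^ 2) - H1 y * H2 y := by
    have : 0 < 1 / (2 * H y ^ 2) := by positivity
    have := h1 y hxy le_rfl
    have := h2 y hxy le_rfl
    nlinarith
  have h4 : 0 ≤ (1 / (2 * H y ^ 2) - H1 y * H2 y) / (y ^ 2 + a) := div_nonneg h3 (by linarith)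
  simp only [mul_zero, sub_zero] at key
  linarith

lemma ratio (h : Sys a H H1 H2) {s α : ℝ} (hs : base a ≤ s) (hsα : s ≤ α)
    (h1 : ∀ u, s ≤ u → u ≤ α → 0 ≤ H1 u) (hα : (α ^ 2 + a) * H α ^ 3 = 8) :
    1 + α ^ 2 ≤ 256 * (1 + s ^ 2) := by
  have hb := base_ge a
  by_cases hc : α ≤ s + 3
  · nlinarith
  push Not at hc
  have hmono : ∀ u v, s ≤ u → u ≤ v → v ≤ α → H u ≤ H v := by
    intro u v h3 h4 h5
    have := mvt_ge h4 h.d0 (c := 0) (fun r hr1 hr2 => h1 r (by linarith) (by linarith))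
    linarith
  set b := s + 3 with hbd
  have hq := q_big hs
  have hpb := h.pos b
  have hqb := q_big (a := a) (s := b) (by linarith)
  have hlow : 1 / 2 < (b ^ 2 + a) * H b ^ 3 := by
    by_contra hcon
    push Not at hcon
    have hb1 : H b ≤ 1 := by
      by_contra hh
      push Not at hh
      have : (1 : ℝ) < H b ^ 3 := one_lt_pow₀ hh (by norm_num)
      nlinarith
    have h3 := D3 (f := fun t => - H t) (f1 := fun t => - H1 t) (f2 := fun t => - H2 t)
      (f3 := fun t => -(t ^ 2 + a - 1 / H t ^ 3)) (x := s) (δ := 1) (c := s ^ 2 + a) zero_le_one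
      (fun t => (h.d0 t).neg) (fun t => (h.d1 t).neg) (fun t => (h.d2 t).neg) (by
        intro t ht1 ht2
        have hp := h.pos t
        have h4 := q_mono hs ht1
        have h5 := q_mono (a := a) (s := t) (t := b) (by linarith) (by linarith)
        have h6 := hmono t b ht1 (by linarith) hc.le
        have h7 : (t ^ 2 + a) * H t ^ 3 ≤ (b ^ 2 + a) * H b ^ 3 := by
          apply mul_le_mul h5 (by gcongr) (by positivity) (by linarith)
        have h8 : 2 * (t ^ 2 + a) ≤ 1 / H t ^ 3 := by
          rw [le_div_iff₀ (by positivity)]; linarith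
        linarith)
    have e1 := hmono (s + 2 * 1) b (by linarith) (by linarith) hc.le
    have e2 := hmono s b (by linarith) (by linarith) hc.le
    have e3 := h.pos (s + 1)
    have e4 := h.pos (s + 3 * 1)
    linarith
  have h3 := hmono b α (by linarith) hc.le le_rfl
  have h4 : (α ^ 2 + a) * H b ^ 3 ≤ 8 := by
    rw [← hα]
    have := q_big (a := a) (s := α) (by linarith)
    gcongr
  have h5 : α ^ 2 + a ≤ 16 * (b ^ 2 + a) := by
    have hb3 : 0 < H b ^ 3 := by positivity
    have : (α ^ 2 + a) * H b ^ 3 ≤ 16 * (b ^ 2 + a) * H b ^ 3 := by linarith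
    exact le_of_mul_le_mul_right this hb3
  have h6 := q_lo (a := a) (s := α) (by linarith)
  have h7 := q_hi (a := a) (s := b) (by linarith)
  rw [ell_pow] at h6 h7
  nlinarith

lemma excursion (h : Sys a H H1 H2) {S S' t : ℝ} (hS : base a ≤ S) (hS1 : H1 S ≤ 0)
    (hSS : S ≤ S') (hS' : (S' ^ 2 + a) * H S' ^ 3 ≤ 8) (ht : S' ≤ t)
    (hqt : 8 < (t ^ 2 + a) * H t ^ 3) :
    ∃ α, S' ≤ α ∧ α ≤ t ∧ (α ^ 2 + a) * H α ^ 3 = 8 ∧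
      (∀ u, α ≤ u → u ≤ t → 8 ≤ (u ^ 2 + a) * H u ^ 3) ∧
      ((∀ u, α ≤ u → u ≤ t → H u ≤ H α) ∨
        ∃ s, S ≤ s ∧ s ≤ α ∧ H1 s = 0 ∧ 0 ≤ H2 s ∧ 1 + α ^ 2 ≤ 256 * (1 + s ^ 2) ∧
          ∀ u, α ≤ u → u ≤ t → H u * ell s ^ 3 ≤ 2 + (1 / H s) ^ 2 / ell s ^ 6) := by
  have hb := base_ge a
  have hcq : Continuous (fun u => (u ^ 2 + a) * H u ^ 3) := by
    have := h.c0
    fun_prop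
  obtain ⟨α, hα1, hα2, hα3, hα4⟩ := last_time hcq ht hS' hqt
  have hq : ∀ u, α ≤ u → u ≤ t → 8 ≤ (u ^ 2 + a) * H u ^ 3 := by
    intro u hu1 hu2
    rcases eq_or_lt_of_le hu1 with rfl | hlt
    · exact hα3.ge
    · exact (hα4 u hlt hu2).le
  refine ⟨α, hα1, hα2.le, hα3, hq, ?_⟩
  by_cases hH1 : H1 α ≤ 0
  · left
    intro u hu1 hu2
    exact h.decr (by linarith) hu1 (fun v hv1 hv2 => hq v hv1 (by linarith)) hH1
  right
  push Not at hH1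
  obtain ⟨s, hs1, hs2, hs3, hs4⟩ := last_time h.c1 (show S ≤ α by linarith) hS1 hH1
  have hinc : ∀ u, s ≤ u → u ≤ α → 0 ≤ H1 u := by
    intro u hu1 hu2
    rcases eq_or_lt_of_le hu1 with rfl | hlt
    · exact hs3.ge
    · exact (hs4 u hlt hu2).le
  have hH2s : 0 ≤ H2 s := by
    by_contra hcon
    push Not at hcon
    have hev := h.c2.continuousAt.eventually (gt_mem_nhds hcon)
    obtain ⟨ε, hε, hball⟩ := Metric.eventually_nhds_iff.1 hev
    set d := min (ε / 2) (α - s) with hd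
    have hd0 : 0 < d := lt_min (by linarith) (by linarith)
    have hd1 : d ≤ ε / 2 := min_le_left _ _
    have hd2 : d ≤ α - s := min_le_right _ _
    have h3 := mvt_le (x := s) (y := s + d) (by linarith) h.d1 (c := 0) (fun u hu1 hu2 => by
      apply (hball (y := u) ?_).le
      rw [Real.dist_eq, abs_lt]
      constructor <;> linarith)
    have := hs4 (s + d) (by linarith) (by linarith)
    linarith
  refine ⟨s, hs1, hs2.le, hs3, hH2s, h.ratio (by linarith) hs2.le hinc hα3, ?_⟩
  obtain ⟨z, hz, he⟩ := exists_hasDerivAt_eq_slope H1 H2 hs2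
    (fun t _ => (h.d1 t).continuousAt.continuousWithinAt) (fun t _ => h.d1 t)
  have hz2 : 0 < H2 z := by
    rw [he, hs3]
    apply div_pos <;> linarith
  have hneg : ∀ u, α ≤ u → u ≤ t → 0 ≤ H1 u → H2 u < 0 := by
    intro u hu1 hu2 hu3
    by_contra hcon
    push Not at hcon
    have := h.no_escape (s := u) (by linarith) hu3 hcon
    have := hq u hu1 hu2
    linarith
  have hα2' := hneg α le_rfl hα2.le hH1.le
  obtain ⟨p, hp1, hp2, hp3, hp4⟩ := last_time (f := fun u => - H2 u) (h.c2.neg) hz.2.le (d := 0)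
    (by linarith) (by linarith)
  have hp3' : H2 p = 0 := by linarith
  have hsp : s < p := by linarith [hz.1]
  have hHp := h.no_escape (s := p) (by linarith) (hinc p hsp.le hp2.le) hp3'.ge
  have hmono : H s ≤ H p := by
    have := mvt_ge hsp.le h.d0 (c := 0) (fun r hr1 hr2 => hinc r (by linarith) (by linarith))
    linarith
  -- the bound at p
  have hps := h.pos s
  have hpp := h.pos p
  have hls := ell_pos s
  have hlsp : ell s ≤ ell p := ell_mono (by linarith) hsp.le
  have b1 : H p * ell s ^ 3 ≤ 2 := by
    apply le_of_pow_le_pow_left₀ (n := 3) (by norm_num) (by positivity)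
    have := q_lo (a := a) (s := p) (by linarith)
    have h5 : ell s ^ 9 ≤ ell p ^ 9 := by gcongr
    have h6 : 0 < H p ^ 3 := by positivity
    calc (H p * ell s ^ 3) ^ 3 = ell s ^ 9 * H p ^ 3 := by ring
      _ ≤ 2 * (p ^ 2 + a) * H p ^ 3 := by gcongr; linarith
      _ ≤ 2 ^ 3 := by linarith
  have b2 : 1 / (2 * H p ^ 2) / (p ^ 2 + a) * ell s ^ 3 ≤ (1 / H s) ^ 2 / ell s ^ 6 := by
    have h5 := q_lo (a := a) (s := p) (by linarith)
    have h6 : ell s ^ 9 ≤ ell p ^ 9 := by gcongr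
    have h7 : ell s ^ 9 ≤ 2 * (p ^ 2 + a) := by linarith
    have h8 := q_big (a := a) (s := p) (by linarith)
    have e : (1 / H s) ^ 2 / ell s ^ 6 = 1 / (H s ^ 2 * ell s ^ 9) * ell s ^ 3 := by
      field_simp
    rw [e, div_div]
    have h9 : H s ^ 2 * ell s ^ 9 ≤ 2 * H p ^ 2 * (p ^ 2 + a) := by
      calc _ ≤ H p ^ 2 * (2 * (p ^ 2 + a)) := by gcongr
        _ = _ := by ring
    gcongr
  intro u hu1 hu2
  obtain ⟨w, hw1, hw2, hw3, hw4⟩ : ∃ w, α ≤ w ∧ w ≤ u ∧ H u ≤ H w ∧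
      ∀ r, α ≤ r → r ≤ w → 0 ≤ H1 r := by
    by_cases hex : ∃ r, α ≤ r ∧ r ≤ u ∧ H1 r ≤ 0
    · obtain ⟨r, hr1, hr2, hr3⟩ := hex
      obtain ⟨c, hc1, hc2, hc3, hc4⟩ := first_time h.c1 hr1 hH1 hr3
      refine ⟨c, hc1.le, by linarith, h.decr (by linarith) (by linarith)
        (fun v hv1 hv2 => hq v (by linarith) (by linarith)) hc3.le, fun r' hr1' hr2' => ?_⟩
      rcases eq_or_lt_of_le hr2' with rfl | hlt
      · exact hc3.ge
      · exact (hc4 r' hr1' hlt).le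
    · push Not at hex
      exact ⟨u, hu1, le_rfl, le_rfl, fun r h1 h2 => (hex r h1 h2).le⟩
  have hE := h.energy (x := p) (y := w) (by linarith) (by linarith)
    (fun r hr1 hr2 => by
      rcases le_total r α with h5 | h5
      · exact hinc r (by linarith) h5
      · exact hw4 r h5 hr2)
    (fun r hr1 hr2 => by
      rcases le_total r α with h5 | h5
      · rcases eq_or_lt_of_le hr1 with rfl | hlt
        · exact hp3'.le
        · have := hp4 r hlt h5
          linarith
      · exact (hneg r h5 (by linarith) (hw4 r h5 hr2)).le) hp3'
  calc H u * ell s ^ 3 ≤ (H p + 1 / (2 * H p ^ 2) / (p ^ 2 + a)) * ell s ^ 3 := by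
        gcongr; linarith
    _ ≤ _ := by rw [add_mul]; linarith

lemma length (h : Sys a H H1 H2) {α t X D : ℝ} (hα : base a ≤ α)
    (hq : ∀ u, α ≤ u → u ≤ t → 8 ≤ (u ^ 2 + a) * H u ^ 3) (hD : 1 ≤ D)
    (hX : ∀ u, α ≤ u → u ≤ t → H u ≤ X) (hXD : 8 * X < D * (α ^ 2 + a)) : t ≤ α + 3 * D := by
  by_contra hcon
  push Not at hcon
  have hqα := q_big hα
  have h3 := D3 (x := α) (δ := D) (c := (α ^ 2 + a) / 2) (by linarith) h.d0 h.d1 h.d2 (by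
    intro u hu1 hu2
    have h4 := hq u hu1 (by linarith)
    have hp := h.pos u
    have h5 : 1 / H u ^ 3 ≤ (u ^ 2 + a) / 8 := by
      rw [div_le_iff₀ (by positivity)]; linarith
    have h6 := q_mono hα hu1
    linarith)
  have e1 := hX (α + 3 * D) (by linarith) hcon.le
  have e2 := hX (α + D) (by linarith) (by linarith)
  have e3 := h.pos (α + 2 * D)
  have e4 := h.pos α
  have h7 : (α ^ 2 + a) / 2 * D ^ 3 ≤ 4 * X := by linarith
  have h8 : D ≤ D ^ 3 := le_self_pow₀ hD (by norm_num)
  nlinarith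

end Sys

namespace Sys
variable {a : ℝ} {H H1 H2 : ℝ → ℝ}

lemma lowH' (h : Sys a H H1 H2) {s ν C1 : ℝ} (hs : base a + 1 ≤ s) (h1 : H1 s = 0) (h2 : 0 ≤ H2 s)
    (hν : 1 ≤ ν) (hC : 1 ≤ C1) (hb : ∀ u, s - 1 ≤ u → u ≤ s → H2 u ≤ C1 * (ell s ^ 5 * ν ^ 5)) :
    (1 / H s) ^ 2 / ell s ^ 6 ≤ (2048 * C1 ^ 3) ^ 2 * ν ^ 6 := by
  have hl := ell_ge_one s
  have hp := h.pos s
  set l := ell s with hlt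
  have hK : 1 ≤ C1 * (l ^ 5 * ν ^ 5) :=
    one_le_mul_of_one_le_of_one_le hC (one_le_mul_of_one_le_of_one_le (one_le_pow₀ hl) (one_le_pow₀ hν))
  set A := 2048 * C1 ^ 3 with hA
  have hC3 : 1 ≤ C1 ^ 3 := one_le_pow₀ hC
  have hA1 : 2048 ≤ A := by linarith
  have hl0 : 0 < l := by linarith
  have key : 1 / H s ≤ A * (l ^ 3 * ν ^ 3) := by
    rcases h.lowH hs h1 h2 hK hb with h3 | h3
    · apply le_of_pow_le_pow_left₀ (n := 3) (by norm_num) (by positivity)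
      refine h3.trans ?_
      have e1 : 1 ≤ ν ^ 9 := one_le_pow₀ hν
      have e2 : A ≤ A ^ 3 := le_self_pow₀ (by linarith) (by norm_num)
      calc 128 * l ^ 9 ≤ A ^ 3 * (l ^ 9 * ν ^ 9) := by
            have : l ^ 9 ≤ l ^ 9 * ν ^ 9 := le_mul_of_one_le_right (by positivity) e1
            apply mul_le_mul (by linarith) this (by positivity) (by positivity)
        _ = _ := by ring
    · apply le_of_pow_le_pow_left₀ (n := 5) (by norm_num) (by positivity)
      refine h3.trans ?_
      have e2 : A ≤ A ^ 5 := le_self_pow₀ (by linarith) (by norm_num)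
      calc 2048 * (C1 * (l ^ 5 * ν ^ 5)) ^ 3 = A * (l ^ 15 * ν ^ 15) := by rw [hA]; ring
        _ ≤ A ^ 5 * (l ^ 15 * ν ^ 15) := by gcongr
        _ = _ := by ring
  rw [div_le_iff₀ (by positivity)]
  calc (1 / H s) ^ 2 ≤ (A * (l ^ 3 * ν ^ 3)) ^ 2 := by gcongr
    _ = _ := by ring

lemma step (h : Sys a H H1 H2) : ∃ S C : ℝ, base a ≤ S / 200 ∧ 1 ≤ C ∧ ∀ t ν, S ≤ t → 1 ≤ ν →
    (∀ u, t / 200 ≤ u → u ≤ t → H u * ell u ^ 3 ≤ ν ^ 15) → H t * ell t ^ 3 ≤ C * ν ^ 6 := by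
  obtain ⟨C0, hC0, hap⟩ := h.apriori
  set C1 := 18 + 2 * C0 with hC1
  set A := 2048 * C1 ^ 3 with hA
  set D := 16 * (2 + A ^ 2) + 1 with hD
  have hD1 : 1 ≤ D := by nlinarith [sq_nonneg A]
  have hbase := base_ge a
  obtain ⟨S, hS, hS1⟩ := h.exists_nonpos (200 * base a + 3 * D)
  obtain ⟨S', hSS, hS'⟩ := h.exists_le S
  refine ⟨S', 22 + 11 * A ^ 2, by linarith, by nlinarith [sq_nonneg A], ?_⟩
  intro t ν ht hν hb
  have hν6 : 1 ≤ ν ^ 6 := one_le_pow₀ hν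
  have hAν : 0 ≤ A ^ 2 * ν ^ 6 := by positivity
  have three : ∀ r, base a ≤ r → (r ^ 2 + a) * H r ^ 3 ≤ 8 → H r * ell r ^ 3 ≤ 3 := by
    intro r hr hr8
    have hp := h.pos r
    apply le_of_pow_le_pow_left₀ (n := 3) (by norm_num) (by norm_num)
    have := q_lo hr
    calc (H r * ell r ^ 3) ^ 3 = ell r ^ 9 * H r ^ 3 := by ring
      _ ≤ 2 * (r ^ 2 + a) * H r ^ 3 := by gcongr
      _ ≤ 3 ^ 3 := by linarith
  by_cases hqt : (t ^ 2 + a) * H t ^ 3 ≤ 8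
  · have := three t (by linarith) hqt
    nlinarith
  push Not at hqt
  obtain ⟨α, hα1, hα2, hα3, hq, hor⟩ := h.excursion (by linarith) hS1 hSS hS' ht hqt
  rcases hor with hd | ⟨s, hs1, hs2, hs3, hs4, hs5, hs6⟩
  · have hqα := q_big (a := a) (s := α) (by linarith)
    have hpα := h.pos α
    have hle : H α ≤ 1 := by
      by_contra hh
      push Not at hh
      have : (1 : ℝ) < H α ^ 3 := one_lt_pow₀ hh (by norm_num)
      nlinarith
    have hlen := h.length (X := H α) (D := 1) (by linarith) hq le_rfl hd (by linarith)
    have h3 := three α (by linarith) hα3.le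
    have h4 := ell_ratio (s := α) (t := t) (m := 2) (by norm_num) (by nlinarith)
    have h5 := hd t hα2 le_rfl
    have h6 := ell_pos t
    have h7 : H t * ell t ^ 3 ≤ H α * (2 * ell α ^ 3) := by
      apply mul_le_mul h5 h4 (by positivity) hpα.le
    nlinarith
  · have hl := ell_ge_one s
    have hl0 := ell_pos s
    have hC11 : 1 ≤ C1 := by linarith
    -- a priori
    have hap2 := h.lowH' (s := s) (ν := ell s ^ 2) (C1 := C1) (by linarith) hs3 hs4 (one_le_pow₀ hl) hC11 (by
      intro u hu1 hu2
      have e1 := hap u (by linarith)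
      have e2 : ell u ≤ ell s := ell_mono (by linarith) hu2
      have e0 := ell_pos u
      have e3 : s ≤ ell s ^ 6 := by
        apply le_of_pow_le_pow_left₀ (n := 2) (by norm_num) (by positivity)
        have : ell s ^ 9 ≤ ell s ^ 12 := pow_le_pow_right₀ hl (by norm_num)
        rw [ell_pow] at this
        calc s ^ 2 ≤ ell s ^ 12 := by linarith
          _ = _ := by ring
      have hu0 : 0 ≤ u := by linarith
      calc H2 u ≤ C0 * (u * ell u ^ 9) := e1
        _ ≤ C1 * (ell s ^ 6 * ell s ^ 9) := by gcongr <;> linarith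
        _ = _ := by ring)
    have hX : ∀ u, α ≤ u → u ≤ t → H u ≤ (2 + A ^ 2) * ell s ^ 9 := by
      intro u hu1 hu2
      have e1 := hs6 u hu1 hu2
      have e2 : 1 ≤ ell s ^ 12 := one_le_pow₀ hl
      have e3 : H u * ell s ^ 3 ≤ (2 + A ^ 2) * ell s ^ 9 * ell s ^ 3 := by
        calc H u * ell s ^ 3 ≤ 2 + A ^ 2 * (ell s ^ 2) ^ 6 := by linarith
          _ ≤ 2 * ell s ^ 12 + A ^ 2 * ell s ^ 12 := by
            have : (ell s ^ 2) ^ 6 = ell s ^ 12 := by ring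
            rw [this]; linarith
          _ = _ := by ring
      exact le_of_mul_le_mul_right e3 (by positivity)
    have hlen := h.length (D := D) (by linarith) hq hD1 hX (by
      have e1 := q_lo (a := a) (s := s) (by linarith)
      have e2 := q_mono (a := a) (s := s) (by linarith) hs2
      have e3 := q_big (a := a) (s := s) (by linarith)
      have e4 : (2 + A ^ 2) * ell s ^ 9 ≤ (2 + A ^ 2) * (2 * (α ^ 2 + a)) := by
        gcongr; linarith
      rw [hD]; linarith)
    have hts : 1 + t ^ 2 ≤ 1024 * (1 + s ^ 2) := by
      have e1 : t ≤ 2 * α := by linarith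
      have e2 : t ^ 2 ≤ (2 * α) ^ 2 := pow_le_pow_left₀ (by linarith) e1 2
      have e3 : (2 * α) ^ 2 = 4 * α ^ 2 := by ring
      linarith
    have hts' : t ≤ 33 * s := by
      by_contra hcon
      push Not at hcon
      have e2 : (33 * s) ^ 2 ≤ t ^ 2 := pow_le_pow_left₀ (by linarith) hcon.le 2
      have e3 : (33 * s) ^ 2 = 1089 * s ^ 2 := by ring
      have e4 : (10 : ℝ) ^ 2 ≤ s ^ 2 := pow_le_pow_left₀ (by norm_num) (by linarith) 2
      linarith
    have hfin := h.lowH' (s := s) (ν := ν) (C1 := C1) (by linarith) hs3 hs4 hν hC11 (by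
      intro u hu1 hu2
      have e2 : ell u ≤ ell s := ell_mono (by linarith) hu2
      have e0 := ell_pos u
      have := h.upK hC0 hap (t := u) (ν := ν) (by linarith) hν (fun v hv1 hv2 => hb v (by linarith) (by linarith))
      calc H2 u ≤ C1 * (ell u ^ 5 * ν ^ 5) := this
        _ ≤ _ := by gcongr)
    have e1 := hs6 t hα2 le_rfl
    have e2 := ell_ratio (s := s) (t := t) (m := 11) (by norm_num) (by linarith [sq_nonneg s])
    have hpt := h.pos t
    calc H t * ell t ^ 3 ≤ H t * (11 * ell s ^ 3) := by gcongr
      _ = 11 * (H t * ell s ^ 3) := by ring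
      _ ≤ 11 * (2 + A ^ 2 * ν ^ 6) := by linarith
      _ ≤ 22 * ν ^ 6 + 11 * A ^ 2 * ν ^ 6 := by linarith
      _ = _ := by ring

lemma bdd (h : Sys a H H1 H2) : ∃ S ν : ℝ, 2 * base a ≤ S ∧ 1 ≤ ν ∧ ∀ t, S / 2 ≤ t → H t * ell t ^ 3 ≤ ν ^ 15 := by
  obtain ⟨S, C, hS, hC, hst⟩ := h.step
  have hbase := base_ge a
  have hcont : Continuous (fun t => H t * ell t ^ 3) := h.c0.mul (ell_cont.pow 3)
  obtain ⟨M, hM⟩ := (isCompact_Icc (a := S / 200) (b := S)).bddAbove_image hcont.continuousOn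
  have hM' : ∀ t, S / 200 ≤ t → t ≤ S → H t * ell t ^ 3 ≤ M := fun t h1 h2 =>
    hM ⟨t, ⟨h1, h2⟩, rfl⟩
  set ν := 1 + |M| + C with hν
  have hM0 := abs_nonneg M
  have hM1 := le_abs_self M
  have hν1 : 1 ≤ ν := by linarith
  have hν15 : ν ≤ ν ^ 15 := le_self_pow₀ hν1 (by norm_num)
  have hall : ∀ t, S / 200 ≤ t → H t * ell t ^ 3 ≤ ν ^ 15 := by
    intro t ht
    by_contra hcon
    push Not at hcon
    obtain ⟨c, hc1, hc2, hc3, hc4⟩ := first_time (f := fun t => - (H t * ell t ^ 3)) hcont.neg (x := S / 200)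
      (y := t) (d := - ν ^ 15) ht (by
        have := hM' (S / 200) le_rfl (by linarith)
        linarith) (by linarith)
    have hc3' : H c * ell c ^ 3 = ν ^ 15 := by linarith
    have hSc : S ≤ c := by
      by_contra hh
      push Not at hh
      have := hM' c hc1.le hh.le
      linarith
    have h3 := hst c ν hSc hν1 (fun u hu1 hu2 => by
      rcases eq_or_lt_of_le hu2 with rfl | hlt
      · exact hc3'.le
      · have := hc4 u (by linarith) hlt
        linarith)
    have h4 : 0 < ν ^ 6 := by positivity
    have h5 : ν ^ 7 ≤ ν ^ 15 := pow_le_pow_right₀ hν1 (by norm_num)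
    have h6 : C * ν ^ 6 < ν ^ 7 := by
      calc C * ν ^ 6 < ν * ν ^ 6 := by gcongr; linarith
        _ = _ := by ring
    linarith
  exact ⟨S, ν, by linarith, hν1, fun t ht => hall t (by linarith)⟩

/-- final bounds -/
theorem final (h : Sys a H H1 H2) : ∃ S C : ℝ, 0 ≤ S ∧ ∀ t, S ≤ t →
    H t * ell t ^ 3 ≤ C ∧ |H1 t| ≤ C * ell t ∧ |H2 t| ≤ C * ell t ^ 5 := by
  obtain ⟨S, ν, hS, hν, hb⟩ := h.bdd
  obtain ⟨C0, hC0, hap⟩ := h.apriori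
  have hbase := base_ge a
  set N := ν ^ 15 with hN
  have hN1 : 1 ≤ N := one_le_pow₀ hν
  set C1 := (18 + 2 * C0) * ν ^ 5 with hC1
  have hC10 : 0 < C1 := by positivity
  have hup : ∀ t, S ≤ t → H2 t ≤ C1 * ell t ^ 5 := by
    intro t ht
    have := h.upK hC0 hap (t := t) (ν := ν) (by linarith) hν (fun u hu1 hu2 => hb u (by linarith))
    rw [hC1]; linarith
  have hrat : ∀ t u, S ≤ t → t ≤ u → u ≤ t + 1 → ell u ≤ 2 * ell t := by
    intro t u ht h1 h2
    apply ell_ratio1 (by norm_num)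
    nlinarith
  -- lower bound
  have hlow : ∀ t, S ≤ t → - ((1024 + 8 * N) * ell t ^ 5) ≤ H2 t := by
    intro t ht
    have hl := ell_pos t
    have hl1 := ell_ge_one t
    set l := ell t with hlt
    set R := 1 / l ^ 4 with hR
    have hR0 : 0 < R := by positivity
    have hRl : R * l ^ 4 = 1 := by rw [hR]; field_simp
    have hR1 : R ≤ 1 := by
      rw [hR, div_le_one (by positivity)]; exact one_le_pow₀ hl1
    have hle : ∀ u, t ≤ u → u ≤ t + R → H2 u ≤ H2 t + 1024 * l ^ 5 := by
      intro u hu1 hu2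
      have h1 := mvt_le hu1 h.d2 (c := 1024 * l ^ 9) (fun r hr1 hr2 => by
        have := h.pos r
        have : 0 < 1 / H r ^ 3 := by positivity
        have e1 := q_hi (a := a) (s := r) (by linarith)
        have e2 := hrat t r ht hr1 (by linarith)
        have e0 := ell_pos r
        have e3 : ell r ^ 9 ≤ (2 * l) ^ 9 := by gcongr
        have e4 : (2 * l) ^ 9 = 512 * l ^ 9 := by ring
        linarith)
      have : 1024 * l ^ 9 * (u - t) ≤ 1024 * l ^ 9 * R := by
        have : u - t ≤ R := by linarith
        gcongr
      have e5 : 1024 * l ^ 9 * R = 1024 * l ^ 5 := by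
        calc _ = 1024 * l ^ 5 * (R * l ^ 4) := by ring
          _ = _ := by rw [hRl, mul_one]
      linarith
    have h2 := D2 (f := fun t => - H t) (f1 := fun t => - H1 t) (f2 := fun t => - H2 t) (x := t)
      (δ := R / 2) (c := - (H2 t + 1024 * l ^ 5)) (by positivity) (fun t => (h.d0 t).neg)
      (fun t => (h.d1 t).neg) (fun u hu1 hu2 => by
        have := hle u hu1 (by linarith)
        linarith)
    have p1 := h.pos (t + 2 * (R / 2))
    have p2 := h.pos t
    have e1 := hb (t + R / 2) (by linarith)
    have e2 : l ≤ ell (t + R / 2) := ell_mono (by linarith) (by linarith)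
    have p3 := h.pos (t + R / 2)
    have e3 : H (t + R / 2) * l ^ 3 ≤ N := by
      calc _ ≤ H (t + R / 2) * ell (t + R / 2) ^ 3 := by gcongr
        _ ≤ N := e1
    have h3 : - (H2 t + 1024 * l ^ 5) * (R / 2) ^ 2 * l ^ 3 ≤ 2 * N := by
      calc _ ≤ (2 * H (t + R / 2)) * l ^ 3 :=
            mul_le_mul_of_nonneg_right (by linarith) (by positivity)
        _ ≤ _ := by linarith
    have h4 : - (H2 t + 1024 * l ^ 5) ≤ 8 * N * l ^ 5 := by
      calc - (H2 t + 1024 * l ^ 5) = - (H2 t + 1024 * l ^ 5) * (R * l ^ 4) ^ 2 := by rw [hRl]; ring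
        _ = 4 * l ^ 5 * (- (H2 t + 1024 * l ^ 5) * (R / 2) ^ 2 * l ^ 3) := by ring
        _ ≤ 4 * l ^ 5 * (2 * N) := by gcongr
        _ = _ := by ring
    linarith
  set C2 := C1 + (1024 + 8 * N) with hC2
  have habs : ∀ t, S ≤ t → |H2 t| ≤ C2 * ell t ^ 5 := by
    intro t ht
    have hl := ell_pos t
    have h1 := hup t ht
    have h2 := hlow t ht
    have h3 : 0 < ell t ^ 5 := by positivity
    rw [abs_le]
    constructor <;> nlinarith
  refine ⟨S, N + 32 * C2, by linarith, fun t ht => ⟨?_, ?_, ?_⟩⟩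
  · have := hb t (by linarith)
    nlinarith
  · have hl := ell_pos t
    have hl1 := ell_ge_one t
    set l := ell t with hlt
    set R := 1 / l ^ 4 with hR
    have hR0 : 0 < R := by positivity
    have hRl : R * l ^ 4 = 1 := by rw [hR]; field_simp
    have hR1 : R ≤ 1 := by
      rw [hR, div_le_one (by positivity)]; exact one_le_pow₀ hl1
    obtain ⟨z, hz, he⟩ := exists_hasDerivAt_eq_slope H H1 (show t < t + R by linarith)
      (fun t _ => (h.d0 t).continuousAt.continuousWithinAt) (fun t _ => h.d0 t)
    have hC2p : 0 < C2 := by linarith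
    have hbz : ∀ u, t ≤ u → u ≤ z → |H2 u| ≤ C2 * (32 * l ^ 5) := by
      intro u hu1 hu2
      have e2 := hrat t u ht hu1 (by linarith [hz.2])
      have e0 := ell_pos u
      calc |H2 u| ≤ C2 * ell u ^ 5 := habs u (by linarith)
        _ ≤ C2 * (2 * l) ^ 5 := by gcongr
        _ = _ := by ring
    have m1 := mvt_ge hz.1.le h.d1 (c := - (C2 * (32 * l ^ 5))) (fun u hu1 hu2 => (abs_le.1 (hbz u hu1 hu2)).1)
    have m2 := mvt_le hz.1.le h.d1 (c := (C2 * (32 * l ^ 5))) (fun u hu1 hu2 => (abs_le.1 (hbz u hu1 hu2)).2)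
    have hzR : C2 * (32 * l ^ 5) * (z - t) ≤ 32 * C2 * l := by
      have : z - t ≤ R := by linarith [hz.2]
      calc _ ≤ C2 * (32 * l ^ 5) * R := by gcongr
        _ = 32 * C2 * l * (R * l ^ 4) := by ring
        _ = _ := by rw [hRl, mul_one]
    have hsl : H1 z * R = H (t + R) - H t := by
      rw [he, add_sub_cancel_left, div_mul_cancel₀ _ hR0.ne']
    have hX : ∀ u, t ≤ u → H u * l ^ 3 ≤ N := by
      intro u hu
      have p3 := h.pos u
      have e2 : l ≤ ell u := ell_mono (by linarith) hu
      calc _ ≤ H u * ell u ^ 3 := by gcongr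
        _ ≤ N := hb u (by linarith)
    have x1 := hX (t + R) (by linarith)
    have x2 := hX t le_rfl
    have p1 := h.pos (t + R)
    have p2 := h.pos t
    have eH : H1 z = l * ((H (t + R) * l ^ 3) - H t * l ^ 3) := by
      calc H1 z = H1 z * (R * l ^ 4) := by rw [hRl, mul_one]
        _ = (H1 z * R) * l ^ 4 := by ring
        _ = _ := by rw [hsl]; ring
    have y1 : 0 < H (t + R) * l ^ 3 := by positivity
    have y2 : 0 < H t * l ^ 3 := by positivity
    have z1 : H1 z ≤ l * N := by rw [eH]; gcongr; linarith
    have z2 : - (l * N) ≤ H1 z := by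
      rw [eH, ← mul_neg]; gcongr; linarith
    rw [abs_le]
    constructor <;> linarith
  · have h1 := habs t ht
    have hl := ell_pos t
    have h3 : 0 < ell t ^ 5 := by positivity
    nlinarith

end Sys

lemma ell_deriv (x : ℝ) : HasDerivAt ell (2 / 9 * x / ell x ^ 8) x := by
  have hp : 0 < 1 + x ^ 2 := by positivity
  have h1 : HasDerivAt (fun x : ℝ => 1 + x ^ 2) (2 * x) x := by
    simpa using (hasDerivAt_pow 2 x).const_add 1
  have h2 := h1.rpow_const (p := (1 : ℝ) / 9) (Or.inl hp.ne')
  refine HasDerivAt.congr_deriv (f := ell) h2 ?_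
  rw [Real.rpow_sub hp, Real.rpow_one]
  have e : (1 + x ^ 2) ^ ((1 : ℝ) / 9) = ell x := rfl
  rw [e, ← ell_pow]
  have := ell_pos x
  field_simp

lemma ell_inv_deriv (n : ℕ) (x : ℝ) :
    HasDerivAt (fun x => 1 / ell x ^ n) (-(2 * n / 9) * x / ell x ^ (n + 9)) x := by
  have hp := ell_pos x
  have h := ((ell_deriv x).pow n).inv (by simpa using (pow_pos hp n).ne')
  simp only [one_div]
  refine HasDerivAt.congr_deriv (f := fun x => (ell x ^ n)⁻¹) h ?_
  rcases n with _ | n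
  · simp
  · simp only [Pi.pow_apply, Nat.add_sub_cancel]
    field_simp
    ring

lemma ell5_deriv (x : ℝ) :
    HasDerivAt (fun x => ell x ^ 5) (10 / 9 * x / ell x ^ 4) x := by
  have hp := ell_pos x
  refine HasDerivAt.congr_deriv (f := fun x => ell x ^ 5) ((ell_deriv x).pow 5) ?_
  push_cast
  field_simp
  ring

/-- `cos θ` is a ninth power with `ell (tan θ) = m⁻²`. -/
lemma cos_param {θ : ℝ} (hθ : θ ∈ Set.Ioo (-(Real.pi / 2)) (Real.pi / 2)) :
    ∃ m : ℝ, 0 < m ∧ Real.cos θ = m ^ 9 ∧ ell (Real.tan θ) * m ^ 2 = 1 ∧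
      Real.sin θ = Real.tan θ * m ^ 9 ∧
      ∀ (k : ℕ) (r : ℝ), r = k / 9 → Real.cos θ ^ r = m ^ k := by
  have hc := Real.cos_pos_of_mem_Ioo hθ
  refine ⟨Real.cos θ ^ ((1 : ℝ) / 9), by positivity, ?_, ?_, ?_, ?_⟩
  · rw [← Real.rpow_natCast, ← Real.rpow_mul hc.le]; norm_num
  · unfold ell
    have e : 1 + Real.tan θ ^ 2 = (Real.cos θ ^ 2)⁻¹ := by
      rw [Real.tan_eq_sin_div_cos]
      field_simp
      linarith [Real.sin_sq_add_cos_sq θ]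
    rw [e, ← Real.rpow_natCast (_ ^ ((1 : ℝ) / 9)), ← Real.rpow_mul hc.le, Real.inv_rpow (by positivity),
      ← Real.rpow_natCast, ← Real.rpow_mul hc.le]
    rw [show ((1 : ℝ) / 9 * ((2 : ℕ) : ℝ)) = ((2 : ℕ) : ℝ) * (1 / 9) by ring]
    exact inv_mul_cancel₀ (by positivity)
  · rw [← Real.rpow_natCast, ← Real.rpow_mul hc.le]
    norm_num
    exact (Real.tan_mul_cos hc.ne').symm
  · intro k r hr
    rw [← Real.rpow_natCast, ← Real.rpow_mul hc.le, hr]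
    congr 1; ring

lemma dPsi_eq (a Φ W Ψ : ℝ) {θ : ℝ} (hθ : θ ∈ Set.Ioo (-(Real.pi / 2)) (Real.pi / 2)) :
    dPsi a Φ W Ψ θ = 1 / Φ ^ 3 - 1 - (a - 1) / ell (Real.tan θ) ^ 9 -
      ((16 / 3 * Real.tan θ / ell (Real.tan θ) ^ 30 - 224 / 27 * Real.tan θ ^ 3 / ell (Real.tan θ) ^ 39) * Φ
      + (208 / 81 * Real.tan θ ^ 2 / ell (Real.tan θ) ^ 26 - 10 / 9 / ell (Real.tan θ) ^ 17) * W
      + 2 / 3 * Real.tan θ / ell (Real.tan θ) ^ 13 * Ψ) := by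
  obtain ⟨m, hm, h1, h2, h3, h4⟩ := cos_param hθ
  unfold dPsi
  rw [h4 51 _ (by norm_num), h4 34 _ (by norm_num), h4 17 _ (by norm_num), h3, h1]
  have e : ell (Real.tan θ) = 1 / m ^ 2 := by
    rw [eq_div_iff (by positivity)]; exact h2
  rw [e]
  generalize Real.tan θ = x
  simp only [div_pow, one_pow, div_div_eq_mul_div, div_one, ← pow_mul]
  ring

theorem toSys (a : ℝ) (Φ W Ψ θ : ℝ → ℝ)
    (hsol : SolD a Φ W Ψ θ)
    (hΦpos : ∀ τ : ℝ, 0 < Φ τ)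
    (hθ : ∀ τ : ℝ, θ τ ∈ Set.Ioo (-(Real.pi / 2)) (Real.pi / 2)) :
    ∃ T : ℝ → ℝ, StrictMono T ∧ (∀ τ, T (Real.tan (θ τ)) = τ) ∧ (∀ x, Real.tan (θ (T x)) = x) ∧
      ∀ x, HasDerivAt T (ell x ^ 4) x := by
  have hcell : Continuous (fun x => ell x ^ 4) := ell_cont.pow 4
  set T : ℝ → ℝ := fun x => ∫ u in (Real.tan (θ 0))..x, ell u ^ 4 with hT
  have hTd : ∀ x, HasDerivAt T (ell x ^ 4) x := fun x =>
    intervalIntegral.integral_hasDerivAt_right (hcell.intervalIntegrable _ _)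
      (hcell.stronglyMeasurableAtFilter _ _) hcell.continuousAt
  have hmono : StrictMono T := strictMono_of_deriv_pos (fun x => by
    rw [(hTd x).deriv]; have := ell_pos x; positivity)
  have hid : ∀ τ, T (Real.tan (θ τ)) = τ := by
    have hd : ∀ τ, HasDerivAt (fun τ => T (Real.tan (θ τ)) - τ) 0 τ := by
      intro τ
      obtain ⟨m, hm, h1, h2, h3, h4⟩ := cos_param (hθ τ)
      have hc := Real.cos_pos_of_mem_Ioo (hθ τ)
      have e1 := (Real.hasDerivAt_tan hc.ne').comp τ (hsol τ).2.2.2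
      have e2 := ((hTd (Real.tan (θ τ))).comp τ e1).sub (hasDerivAt_id τ)
      refine HasDerivAt.congr_deriv (f := fun τ => T (Real.tan (θ τ)) - τ) e2 ?_
      rw [h4 26 _ (by norm_num), h1]
      have e : ell (Real.tan (θ τ)) = 1 / m ^ 2 := by
        rw [eq_div_iff (by positivity)]; exact h2
      rw [e]
      field_simp
      simp
    intro τ
    have := is_const_of_deriv_eq_zero (fun τ => (hd τ).differentiableAt) (fun τ => (hd τ).deriv) τ 0
    have h0 : T (Real.tan (θ 0)) = 0 := by simp [hT]
    simp only [h0] at this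
    linarith
  exact ⟨T, hmono, hid, fun x => hmono.injective (hid (T x)), hTd⟩

lemma h2_deriv (a : ℝ) (Φ W Ψ θ T : ℝ → ℝ)
    (hsol : SolD a Φ W Ψ θ)
    (hΦpos : ∀ τ : ℝ, 0 < Φ τ)
    (hθ : ∀ τ : ℝ, θ τ ∈ Set.Ioo (-(Real.pi / 2)) (Real.pi / 2))
    (hT : ∀ x, Real.tan (θ (T x)) = x) (hTd : ∀ x, HasDerivAt T (ell x ^ 4) x) (x : ℝ) :
    HasDerivAt (fun x => 1 / ell x ^ 3 * Φ (T x))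
      (ell x * W (T x) - 2 / 3 * x * (1 / ell x ^ 12) * Φ (T x)) x ∧
    HasDerivAt (fun x => ell x * W (T x) - 2 / 3 * x * (1 / ell x ^ 12) * Φ (T x))
      (ell x ^ 5 * Ψ (T x) - 4 / 9 * x * (1 / ell x ^ 8) * W (T x)
        + (16 / 9 * x ^ 2 * (1 / ell x ^ 21) - 2 / 3 * (1 / ell x ^ 12)) * Φ (T x)) x ∧
    HasDerivAt (fun x => ell x ^ 5 * Ψ (T x) - 4 / 9 * x * (1 / ell x ^ 8) * W (T x)
        + (16 / 9 * x ^ 2 * (1 / ell x ^ 21) - 2 / 3 * (1 / ell x ^ 12)) * Φ (T x))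
      (1 / (1 / ell x ^ 3 * Φ (T x)) ^ 3 - (x ^ 2 + a)) x := by
  have hl := ell_pos x
  have hp := hΦpos (T x)
  have dΦ : HasDerivAt (fun x => Φ (T x)) (W (T x) * ell x ^ 4) x := (hsol (T x)).1.comp x (hTd x)
  have dW : HasDerivAt (fun x => W (T x)) (Ψ (T x) * ell x ^ 4) x := (hsol (T x)).2.1.comp x (hTd x)
  have dΨ : HasDerivAt (fun x => Ψ (T x)) (_ * ell x ^ 4) x := (hsol (T x)).2.2.1.comp x (hTd x)
  rw [dPsi_eq _ _ _ _ (hθ (T x)), hT x] at dΨ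
  have dx : HasDerivAt (fun x : ℝ => x) 1 x := hasDerivAt_id x
  have dx2 : HasDerivAt (fun x : ℝ => x ^ 2) (2 * x) x := by simpa using hasDerivAt_pow 2 x
  refine ⟨?_, ?_, ?_⟩
  · refine ((ell_inv_deriv 3 x).fun_mul dΦ).congr_deriv ?_
    push_cast
    field_simp
    ring
  · refine (((ell_deriv x).fun_mul dW).fun_sub
      (((dx.const_mul (2 / 3)).fun_mul (ell_inv_deriv 12 x)).fun_mul dΦ)).congr_deriv ?_
    push_cast
    field_simp
    ring
  · refine ((((ell5_deriv x).fun_mul dΨ).fun_sub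
      (((dx.const_mul (4 / 9)).fun_mul (ell_inv_deriv 8 x)).fun_mul dW)).fun_add
      ((((dx2.const_mul (16 / 9)).fun_mul (ell_inv_deriv 21 x)).fun_sub
        ((ell_inv_deriv 12 x).const_mul (2 / 3))).fun_mul dΦ)).congr_deriv ?_
    have hl9 := ell_pow x
    have e : x ^ 2 + a = ell x ^ 9 + (a - 1) := by rw [hl9]; ring
    rw [e]
    push_cast
    generalize ell x = l at *
    generalize Φ (T x) = p at *
    generalize W (T x) = w at *
    generalize Ψ (T x) = y at *
    field_simp
    ring

/-- existence of a sequence of local maxima going to `-∞`, with unbounded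
maximal values, which is eventually strictly decreasing in value. -/
theorem maxima_eventually_decreasing (a : ℝ) (Φ W Ψ θ : ℝ → ℝ)
    (hsol : SolD a Φ W Ψ θ)
    (hΦpos : ∀ τ : ℝ, 0 < Φ τ)
    (hθ : ∀ τ : ℝ, θ τ ∈ Set.Ioo (-(Real.pi / 2)) (Real.pi / 2))
    (hliminf : Filter.liminf (fun τ : ℝ => ((Φ τ : ℝ) : EReal)) atBot < ⊤)
    (hlimsup : Filter.limsup (fun τ : ℝ => ((Φ τ + |W τ| + |Ψ τ| : ℝ) : EReal)) atBot = ⊤) :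
    ∃ τs : ℕ → ℝ, StrictAnti τs ∧ Tendsto τs atTop atBot ∧
      (∃ ε : ℕ → ℝ, (∀ n, 0 < ε n) ∧
        ∀ n, IsMaxOn Φ (Set.Icc (τs n - ε n) (τs n + ε n)) (τs n)) ∧
      Filter.limsup (fun n : ℕ => ((Φ (τs n) : ℝ) : EReal)) atTop = ⊤ ∧
      ∃ n₀ : ℕ, ∀ n : ℕ, n₀ < n → Φ (τs n) < Φ (τs (n - 1)) := by
  exfalso
  obtain ⟨T, hmono, hid, hT, hTd⟩ := toSys a Φ W Ψ θ hsol hΦpos hθ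
  have hder := h2_deriv a Φ W Ψ θ T hsol hΦpos hθ hT hTd
  have hev : ∀ x, ell (-x) = ell x := fun x => by unfold ell; rw [neg_sq]
  set h0 : ℝ → ℝ := fun x => 1 / ell x ^ 3 * Φ (T x) with hh0
  set h1 : ℝ → ℝ := fun x => ell x * W (T x) - 2 / 3 * x * (1 / ell x ^ 12) * Φ (T x) with hh1
  set h2 : ℝ → ℝ := fun x => ell x ^ 5 * Ψ (T x) - 4 / 9 * x * (1 / ell x ^ 8) * W (T x)
        + (16 / 9 * x ^ 2 * (1 / ell x ^ 21) - 2 / 3 * (1 / ell x ^ 12)) * Φ (T x) with hh2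
  have hsys : Sys a (fun s => h0 (-s)) (fun s => - h1 (-s)) (fun s => h2 (-s)) := by
    refine ⟨fun t => ?_, fun t => ?_, fun t => ?_, fun t => ?_, ?_⟩
    · have := (hder (-t)).1.comp t (hasDerivAt_neg t)
      exact this.congr_deriv (by simp only [hh1]; ring)
    · have := ((hder (-t)).2.1.comp t (hasDerivAt_neg t)).neg
      exact this.congr_deriv (by simp only [hh2]; ring)
    · have := (hder (-t)).2.2.comp t (hasDerivAt_neg t)
      refine this.congr_deriv ?_
      simp only [hh0]
      ring
    · have := ell_pos (-t)
      have := hΦpos (T (-t))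
      simp only [hh0]
      positivity
    · obtain ⟨N, hN1, -⟩ := EReal.lt_iff_exists_real_btwn.1 hliminf
      have hfr := Filter.frequently_lt_of_liminf_lt (by isBoundedDefault) hN1
      refine ⟨N, fun S => ?_⟩
      obtain ⟨τ, hτ1, hτ2⟩ := (hfr.and_eventually (eventually_le_atBot (T (-S)))).exists
      have hle : Real.tan (θ τ) ≤ -S := by
        rw [← hid τ] at hτ2
        exact hmono.le_iff_le.1 hτ2
      refine ⟨- Real.tan (θ τ), by linarith, ?_⟩
      simp only [hh0, neg_neg, hid]
      have e1 : Φ τ < N := by exact_mod_cast hτ1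
      have e2 : 1 ≤ ell (Real.tan (θ τ)) ^ 3 := one_le_pow₀ (ell_ge_one _)
      have e3 : 1 / ell (Real.tan (θ τ)) ^ 3 ≤ 1 := by
        rw [div_le_one (by linarith)]; exact e2
      have := hΦpos τ
      nlinarith
  obtain ⟨S, C, hS, hfin⟩ := hsys.final
  have hbound : ∀ τ, τ ≤ T (-S) → Φ τ + |W τ| + |Ψ τ| ≤ 10 * C := by
    intro τ hτ
    have hle : Real.tan (θ τ) ≤ -S := by
      rw [← hid τ] at hτ
      exact hmono.le_iff_le.1 hτ
    obtain ⟨b0, b1, b2⟩ := hfin (- Real.tan (θ τ)) (by linarith)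
    simp only [hh0, hh1, hh2, neg_neg, hid, hev, abs_neg] at b0 b1 b2
    have hl := ell_ge_one (Real.tan (θ τ))
    have hl9 := ell_pow (Real.tan (θ τ))
    have hp := hΦpos τ
    generalize Real.tan (θ τ) = x at *
    generalize ell x = l at *
    generalize Φ τ = p at *
    generalize W τ = w at *
    generalize Ψ τ = y at *
    have hl0 : 0 < l := by linarith
    have c0 : p ≤ C := by
      have : 1 / l ^ 3 * p * l ^ 3 = p := by field_simp
      linarith
    have hx : |x| ≤ l ^ 9 := by
      rw [hl9, abs_le]; constructor <;> nlinarith [sq_nonneg (x - 1), sq_nonneg (x + 1)]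
    -- bound on w
    have cw : |w| ≤ 2 * C := by
      have e : l * w = (l * w - 2 / 3 * x * (1 / l ^ 12) * p) + 2 / 3 * x * (1 / l ^ 12) * p := by ring
      have e2 : |2 / 3 * x * (1 / l ^ 12) * p| ≤ C * l := by
        rw [abs_mul, abs_mul, abs_mul, abs_of_pos hp, abs_of_pos (show (0:ℝ) < 2 / 3 by norm_num),
          abs_of_pos (show 0 < 1 / l ^ 12 by positivity)]
        have : |x| * (1 / l ^ 12) ≤ 1 := by
          rw [mul_one_div, div_le_one (by positivity)]
          exact hx.trans (pow_le_pow_right₀ hl (by norm_num))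
        have h0 : 0 ≤ |x| * (1 / l ^ 12) := by positivity
        calc _ = 2 / 3 * (|x| * (1 / l ^ 12)) * p := by ring
          _ ≤ 1 * 1 * p := by gcongr; norm_num
          _ ≤ C * l := by nlinarith
      have e3 : |l * w| ≤ C * l + C * l := by
        rw [e]; exact (abs_add_le _ _).trans (add_le_add b1 e2)
      rw [abs_mul, abs_of_pos hl0] at e3
      have : l * |w| ≤ l * (2 * C) := by linarith
      exact le_of_mul_le_mul_left this hl0
    have cy : |y| ≤ 7 * C := by
      have hC : 0 < C := by linarith
      have hl5 : 1 ≤ l ^ 5 := one_le_pow₀ hl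
      have e : l ^ 5 * y = (l ^ 5 * y - 4 / 9 * x * (1 / l ^ 8) * w
        + (16 / 9 * x ^ 2 * (1 / l ^ 21) - 2 / 3 * (1 / l ^ 12)) * p) + (4 / 9 * x * (1 / l ^ 8) * w
        - (16 / 9 * x ^ 2 * (1 / l ^ 21) - 2 / 3 * (1 / l ^ 12)) * p) := by ring
      have e2 : |4 / 9 * x * (1 / l ^ 8) * w| ≤ 2 * C * l ^ 5 := by
        rw [abs_mul, abs_mul, abs_mul, abs_of_pos (show (0:ℝ) < 4 / 9 by norm_num),
          abs_of_pos (show 0 < 1 / l ^ 8 by positivity)]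
        have : |x| * (1 / l ^ 8) ≤ l ^ 5 := by
          rw [mul_one_div, div_le_iff₀ (by positivity), ← pow_add]
          exact hx.trans (pow_le_pow_right₀ hl (by norm_num))
        calc _ = 4 / 9 * (|x| * (1 / l ^ 8)) * |w| := by ring
          _ ≤ 1 * l ^ 5 * (2 * C) := by gcongr; norm_num
          _ = _ := by ring
      have e3 : |(16 / 9 * x ^ 2 * (1 / l ^ 21) - 2 / 3 * (1 / l ^ 12)) * p| ≤ 3 * C * l ^ 5 := by
        rw [abs_mul, abs_of_pos hp]
        have f1 : x ^ 2 * (1 / l ^ 21) ≤ 1 := by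
          rw [mul_one_div, div_le_one (by positivity)]
          have : l ^ 9 ≤ l ^ 21 := pow_le_pow_right₀ hl (by norm_num)
          linarith
        have f2 : 1 / l ^ 12 ≤ 1 := by
          rw [div_le_one (by positivity)]; exact one_le_pow₀ hl
        have f3 : 0 ≤ x ^ 2 * (1 / l ^ 21) := by positivity
        have f4 : 0 < 1 / l ^ 12 := by positivity
        have f5 : |16 / 9 * x ^ 2 * (1 / l ^ 21) - 2 / 3 * (1 / l ^ 12)| ≤ 3 := by
          rw [abs_le]; constructor <;> linarith
        calc _ ≤ 3 * C := by gcongr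
          _ ≤ _ := le_mul_of_one_le_right (by positivity) hl5
      have e4 : |l ^ 5 * y| ≤ C * l ^ 5 + (2 * C * l ^ 5 + 3 * C * l ^ 5) := by
        rw [e]
        exact (abs_add_le _ _).trans (add_le_add b2 ((abs_sub _ _).trans (add_le_add e2 e3)))
      rw [abs_mul, abs_of_pos (show 0 < l ^ 5 by positivity)] at e4
      have : l ^ 5 * |y| ≤ l ^ 5 * (7 * C) := by nlinarith
      exact le_of_mul_le_mul_left this (by positivity)
    linarith
  have hle : Filter.limsup (fun τ : ℝ => ((Φ τ + |W τ| + |Ψ τ| : ℝ) : EReal)) atBot ≤ ((10 * C : ℝ) : EReal) := by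
    apply Filter.limsup_le_of_le (by isBoundedDefault)
    filter_upwards [eventually_le_atBot (T (-S))] with τ hτ
    exact_mod_cast hbound τ hτ
  rw [hlimsup] at hle
  exact absurd hle (not_le.2 (EReal.coe_lt_top _))
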